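/- arXiv:2002.02266 — 2 statements merged into one kernel-verified Lean document; each statement's English description precedes it below -/
import Mathlib

section
/- There exists a constant C depending only on k such that for every (k+1)-times continuously differentiable u on [a,b] and every element τ_i, the truncated Jacobi projection u_I satisfies sup_{x∈τ_i} |(u-u_I)(x)| + h·sup_{x∈τ_i} |(u-u_I)'(x)| ≤ C h^{k+1} |u|_{k+1,∞,τ_i}. -/
open Set Finset intervalIntegral

/-- The Legendre polynomial of degree `n` (Rodrigues formula), as a real function. -/
noncomputable def legendre (n : ℕ) : ℝ → ℝ :=
  fun s => (1 / ((2 : ℝ) ^ n * n.factorial)) * iteratedDeriv n (fun t : ℝ => (t ^ 2 - 1) ^ n) s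

/-- The affine map sending `[-1,1]` onto `[p,q]`. -/
noncomputable def affMap (p q s : ℝ) : ℝ := (p + q) / 2 + s * (q - p) / 2

/-- `x 0 = a < x 1 < ... < x N = b` is a partition of `[a,b]`. -/
def IsMesh (a b : ℝ) (N : ℕ) (x : ℕ → ℝ) : Prop :=
  1 ≤ N ∧ x 0 = a ∧ x N = b ∧ ∀ i < N, x i < x (i + 1)

/-- `h` is the maximal element length `h = max_i (x i - x (i-1))`. -/
def IsMeshSize (N : ℕ) (x : ℕ → ℝ) (h : ℝ) : Prop :=
  (∀ i ∈ Finset.Icc 1 N, x i - x (i - 1) ≤ h) ∧ ∃ i ∈ Finset.Icc 1 N, x i - x (i - 1) = h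

/-- Quasi-uniformity with constant `c`: `h ≤ c · h_i` for all elements. -/
def IsQuasiUniform (N : ℕ) (x : ℕ → ℝ) (h c : ℝ) : Prop :=
  ∀ i ∈ Finset.Icc 1 N, h ≤ c * (x i - x (i - 1))

/-- `P i` are the element polynomials (degree ≤ k) of a member of `V_h^0`:
a C¹ piecewise polynomial vanishing at both ends of `[a,b]`. -/
def IsVh0 (k N : ℕ) (x : ℕ → ℝ) (P : ℕ → Polynomial ℝ) : Prop :=
  (∀ i ∈ Finset.Icc 1 N, (P i).natDegree ≤ k) ∧
  (∀ i ∈ Finset.Icc 1 (N - 1), (P i).eval (x i) = (P (i + 1)).eval (x i)) ∧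
  (∀ i ∈ Finset.Icc 1 (N - 1),
      (Polynomial.derivative (P i)).eval (x i) = (Polynomial.derivative (P (i + 1))).eval (x i)) ∧
  (P 1).eval (x 0) = 0 ∧ (P N).eval (x N) = 0

/-- `P i` are the element polynomials of a Petrov–Galerkin solution `u_h ∈ V_h^0`:
`∑_i ∫_{τ_i} (-α u_h'' + β u_h' + γ u_h) v_h = ∫_a^b f v_h` for all `v_h ∈ W_h`. -/
def IsPGSol (k N : ℕ) (x : ℕ → ℝ) (α β γ : ℝ) (f : ℝ → ℝ) (P : ℕ → Polynomial ℝ) : Prop :=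
  IsVh0 k N x P ∧
  ∀ Q : ℕ → Polynomial ℝ, (∀ i ∈ Finset.Icc 1 N, (Q i).natDegree ≤ k - 2) →
    (∑ i ∈ Finset.Icc 1 N, ∫ t in (x (i - 1))..(x i),
        (-α * ((Polynomial.derivative (Polynomial.derivative (P i))).eval t)
            + β * ((Polynomial.derivative (P i)).eval t) + γ * (P i).eval t) * (Q i).eval t)
      = ∑ i ∈ Finset.Icc 1 N, ∫ t in (x (i - 1))..(x i), f t * (Q i).eval t

/-- `P i` are the element polynomials of a Gauss collocation solution `ū_h ∈ V_h^0`: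
`(-α ū_h'' + β ū_h' + γ ū_h)(g) = f(g)` at every Gauss point `g` of every element. -/
def IsGaussSol (k N : ℕ) (x : ℕ → ℝ) (α β γ : ℝ) (f : ℝ → ℝ) (P : ℕ → Polynomial ℝ) : Prop :=
  IsVh0 k N x P ∧
  ∀ i ∈ Finset.Icc 1 N, ∀ s ∈ Set.Ioo (-1 : ℝ) 1, legendre (k - 1) s = 0 →
    -α * ((Polynomial.derivative (Polynomial.derivative (P i))).eval (affMap (x (i - 1)) (x i) s))
        + β * ((Polynomial.derivative (P i)).eval (affMap (x (i - 1)) (x i) s))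
        + γ * (P i).eval (affMap (x (i - 1)) (x i) s)
      = f (affMap (x (i - 1)) (x i) s)

/-- `p` is the elementwise truncated Jacobi projection of `u` on the element `[xl, xr]`:
the polynomial of degree ≤ k matching `u` and `u'` at both endpoints with
`(u - p)'' ⊥ P_{k-2}` in `L²(xl, xr)`. -/
def IsElemProj (k : ℕ) (u : ℝ → ℝ) (xl xr : ℝ) (p : Polynomial ℝ) : Prop :=
  p.natDegree ≤ k ∧ p.eval xl = u xl ∧ p.eval xr = u xr ∧
  (Polynomial.derivative p).eval xl = deriv u xl ∧
  (Polynomial.derivative p).eval xr = deriv u xr ∧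
  ∀ q : Polynomial ℝ, q.natDegree ≤ k - 2 →
    (∫ t in xl..xr,
        (iteratedDeriv 2 u t - (Polynomial.derivative (Polynomial.derivative p)).eval t)
          * q.eval t) = 0

/-- A continuous function with zero integral over `[l, r]` vanishes somewhere in `(l, r)`. -/
theorem exists_mem_Ioo_eq_zero_of_integral_eq_zero {g : ℝ → ℝ} (hg : Continuous g) {l r : ℝ}
    (hlr : l < r) (h0 : ∫ t in l..r, g t = 0) : ∃ c ∈ Set.Ioo l r, g c = 0 := by
  have hd : ∀ y, HasDerivAt (fun y => ∫ t in l..y, g t) (g y) y := fun y =>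
    intervalIntegral.integral_hasDerivAt_right (hg.intervalIntegrable _ _)
      hg.aestronglyMeasurable.stronglyMeasurableAtFilter hg.continuousAt
  exact exists_hasDerivAt_eq_zero hlr (fun y _ => (hd y).continuousAt.continuousWithinAt)
    (by simp [h0]) fun y _ => hd y

/-- Iterated integration by parts against a polynomial with vanishing boundary values. -/
theorem integral_mul_iterate_derivative_eval {l r : ℝ} (W : Polynomial ℝ) (j : ℕ) (f : ℝ → ℝ)
    (hf : ContDiff ℝ j f)
    (hW : ∀ i < j, (Polynomial.derivative^[i] W).eval l = 0 ∧
      (Polynomial.derivative^[i] W).eval r = 0) :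
    ∫ t in l..r, f t * (Polynomial.derivative^[j] W).eval t =
      (-1) ^ j * ∫ t in l..r, iteratedDeriv j f t * W.eval t := by
  induction j generalizing f with
  | zero => simp
  | succ j ih =>
    have hf' : ContDiff ℝ j (deriv f) := by
      refine ContDiff.deriv' ?_
      exact_mod_cast hf
    have hdiff : Differentiable ℝ f := hf.differentiable (by simp)
    have hparts := intervalIntegral.integral_mul_deriv_eq_deriv_mul (a := l) (b := r)
      (u := f) (v := fun t => (Polynomial.derivative^[j] W).eval t) (u' := deriv f)
      (v' := fun t => (Polynomial.derivative (Polynomial.derivative^[j] W)).eval t)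
      (fun t _ => (hdiff t).hasDerivAt) (fun t _ => Polynomial.hasDerivAt _ _)
      (hf'.continuous.intervalIntegrable _ _)
      ((Polynomial.continuous _).intervalIntegrable _ _)
    have hb := hW j (Nat.lt_succ_self j)
    rw [Function.iterate_succ_apply', hparts, hb.1, hb.2,
      ih (deriv f) hf' fun i hi => hW i (hi.trans (Nat.lt_succ_self j)), iteratedDeriv_succ']
    ring

/-- If `f` is orthogonal to all polynomials of degree `≤ m` on `[l, r]`, then each derivative of
`f` of order `j ≤ m` vanishes somewhere in `(l, r)`. -/
theorem exists_iteratedDeriv_eq_zero_of_orthogonal {l r : ℝ} (hlr : l < r) {m j : ℕ}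
    (hjm : j ≤ m) {f : ℝ → ℝ} (hf : ContDiff ℝ j f)
    (horth : ∀ q : Polynomial ℝ, q.natDegree ≤ m → ∫ t in l..r, f t * q.eval t = 0) :
    ∃ c ∈ Set.Ioo l r, iteratedDeriv j f c = 0 := by
  set W : Polynomial ℝ :=
    (Polynomial.X - Polynomial.C l) ^ j * (Polynomial.X - Polynomial.C r) ^ j with hW
  have hroot : ∀ c : ℝ, (Polynomial.X - Polynomial.C c) ^ j ∣ W → ∀ i < j,
      (Polynomial.derivative^[i] W).eval c = 0 := by
    intro c hc i hi
    have h1 := Polynomial.pow_sub_dvd_iterate_derivative_of_pow_dvd i hc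
    exact Polynomial.dvd_iff_isRoot.mp ((dvd_pow_self _ (Nat.sub_ne_zero_of_lt hi)).trans h1)
  have hdeg : (Polynomial.derivative^[j] W).natDegree ≤ m := by
    have h1 := Polynomial.natDegree_iterate_derivative W j
    have h2 : W.natDegree ≤ j + j := by
      refine Polynomial.natDegree_mul_le.trans ?_
      simp [Polynomial.natDegree_pow]
    omega
  have h0 := horth _ hdeg
  rw [integral_mul_iterate_derivative_eval W j f hf fun i hi =>
    ⟨hroot l (dvd_mul_right _ _) i hi, hroot r (dvd_mul_left _ _) i hi⟩] at h0
  obtain ⟨c, hc, hc0⟩ := exists_mem_Ioo_eq_zero_of_integral_eq_zero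
    ((hf.continuous_iteratedDeriv j le_rfl).mul W.continuous) hlr
    ((mul_eq_zero.mp h0).resolve_left (by simp))
  refine ⟨c, hc, (mul_eq_zero.mp hc0).resolve_right ?_⟩
  have hl : c - l ≠ 0 := sub_ne_zero.mpr hc.1.ne'
  have hr : c - r ≠ 0 := sub_ne_zero.mpr hc.2.ne
  simp [hW, hl, hr]

/-- If the derivatives of `f` of order `< n` all have a zero in `[l, r]`, a bound on the `n`-th
derivative propagates to the lower derivatives. -/
theorem abs_iteratedDeriv_le_of_exists_zeros {l r M : ℝ} {n : ℕ} {f : ℝ → ℝ}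
    (hf : ContDiff ℝ n f) (hz : ∀ j < n, ∃ z ∈ Set.Icc l r, iteratedDeriv j f z = 0)
    (hM : ∀ y ∈ Set.Icc l r, |iteratedDeriv n f y| ≤ M) {i j : ℕ} (hij : i + j = n) :
    ∀ y ∈ Set.Icc l r, |iteratedDeriv i f y| ≤ M * (r - l) ^ j := by
  induction j generalizing i with
  | zero =>
    obtain rfl : i = n := by omega
    simpa using hM
  | succ j ih =>
    intro y hy
    have hi : i < n := by omega
    obtain ⟨z, hz, hz0⟩ := hz i hi
    have hb := ih (i := i + 1) (by omega)
    have hB : 0 ≤ M * (r - l) ^ j := (abs_nonneg _).trans (hb y hy)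
    have hmv := (convex_Icc l r).norm_image_sub_le_of_norm_deriv_le (f := iteratedDeriv i f)
      (fun t _ => (hf.differentiable_iteratedDeriv i (by exact_mod_cast hi)) t)
      (fun t ht => by simpa [← iteratedDeriv_succ] using hb t ht) hz hy
    rw [hz0, sub_zero, Real.norm_eq_abs, Real.norm_eq_abs] at hmv
    have hyz : |y - z| ≤ r - l := abs_sub_le_iff.mpr
      ⟨by linarith [hy.2, hz.1], by linarith [hy.1, hz.2]⟩
    calc _ ≤ M * (r - l) ^ j * |y - z| := hmv
      _ ≤ M * (r - l) ^ j * (r - l) := by gcongr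
      _ = _ := by ring

theorem iteratedDeriv_polynomial_eval (p : Polynomial ℝ) (n : ℕ) :
    iteratedDeriv n (fun t => p.eval t) = fun t => (Polynomial.derivative^[n] p).eval t := by
  induction n with
  | zero => simp
  | succ n ih =>
    ext t
    rw [iteratedDeriv_succ, ih, Function.iterate_succ_apply', Polynomial.deriv]

/-- On one element, the derivatives of order `i ≤ k + 1` of the error of the truncated Jacobi
projection are controlled by the derivative of `u` of order `k + 1`. -/
theorem IsElemProj.abs_iteratedDeriv_sub_le {k : ℕ} (hk : 2 ≤ k) {u : ℝ → ℝ} {l r M : ℝ}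
    {p : Polynomial ℝ} (hp : IsElemProj k u l r p) (hlr : l < r) (hu : ContDiff ℝ (k + 1) u)
    (hM : ∀ y ∈ Set.Ioo l r, |iteratedDeriv (k + 1) u y| ≤ M) {i j : ℕ} (hij : i + j = k + 1) :
    ∀ y ∈ Set.Icc l r,
      |iteratedDeriv i u y - (Polynomial.derivative^[i] p).eval y| ≤ M * (r - l) ^ j := by
  obtain ⟨hdeg, h0, -, h1, -, horth⟩ := hp
  have hu' : ContDiff ℝ ((k + 1 : ℕ) : WithTop ℕ∞) u := by exact_mod_cast hu
  have hpc : ∀ n, ContDiff ℝ n (fun t => p.eval t) := fun n => by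
    simpa using p.contDiff_aeval (𝕜 := ℝ) n
  have hec : ContDiff ℝ ((k + 1 : ℕ) : WithTop ℕ∞) (u - fun t => p.eval t) := hu'.sub (hpc _)
  have he : ∀ n ≤ k + 1, ∀ y, iteratedDeriv n (u - fun t => p.eval t) y =
      iteratedDeriv n u y - (Polynomial.derivative^[n] p).eval y := by
    intro n hn y
    rw [iteratedDeriv_sub ((hu'.of_le (by exact_mod_cast hn)).contDiffAt) (hpc _).contDiffAt,
      iteratedDeriv_polynomial_eval]
  have hM' : ∀ y ∈ Set.Icc l r, |iteratedDeriv (k + 1) (u - fun t => p.eval t) y| ≤ M := by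
    have hc : Continuous fun y => |iteratedDeriv (k + 1) u y| :=
      (hu'.continuous_iteratedDeriv (k + 1) le_rfl).abs
    intro y hy
    rw [he _ le_rfl, Polynomial.iterate_derivative_eq_zero (by omega), Polynomial.eval_zero,
      sub_zero]
    rw [← closure_Ioo hlr.ne] at hy
    exact le_on_closure hM hc.continuousOn continuousOn_const hy
  have hz : ∀ n < k + 1, ∃ z ∈ Set.Icc l r,
      iteratedDeriv n (u - fun t => p.eval t) z = 0 := by
    intro n hn
    rcases Nat.lt_or_ge n 2 with hn2 | hn2
    · refine ⟨l, Set.left_mem_Icc.mpr hlr.le, ?_⟩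
      rw [he n hn.le]
      interval_cases n
      · simp [h0]
      · simp [h1]
    · obtain ⟨m, rfl⟩ := Nat.exists_eq_add_of_le' hn2
      have hcomp : iteratedDeriv (m + 2) (u - fun t => p.eval t) =
          iteratedDeriv m (iteratedDeriv 2 (u - fun t => p.eval t)) := by
        simp only [iteratedDeriv_eq_iterate, Function.iterate_add_apply]
      rw [hcomp]
      obtain ⟨c, hc, hc0⟩ := exists_iteratedDeriv_eq_zero_of_orthogonal hlr
        (m := k - 2) (j := m) (f := iteratedDeriv 2 (u - fun t => p.eval t)) (by omega)
        (by
          rw [iteratedDeriv_eq_iterate]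
          refine ContDiff.iterate_deriv' m 2 (hec.of_le ?_)
          exact_mod_cast hn.le)
        (fun q hq => by
          rw [← horth q hq]
          refine intervalIntegral.integral_congr fun t _ => ?_
          simp only [he 2 (by omega), Function.iterate_succ_apply', Function.iterate_zero, id])
      exact ⟨c, Set.Ioo_subset_Icc_self hc, hc0⟩
  intro y hy
  rw [← he i (by omega)]
  exact abs_iteratedDeriv_le_of_exists_zeros hec hz hM' hij y hy

/-- Optimal error estimates for the truncated Jacobi projection: there is `C = C(k)` with
`sup_{τ_i} |u - u_I| + h · sup_{τ_i} |(u - u_I)'| ≤ C h^{k+1} |u|_{k+1,∞,τ_i}`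
on every element `τ_i`, for every `C^{k+1}` function `u`. -/
theorem truncated_jacobi_projection_optimal_estimate (k : ℕ) (hk : 3 ≤ k) :
    ∃ C > 0, ∀ (a b : ℝ), a < b → ∀ (N : ℕ) (x : ℕ → ℝ) (h : ℝ),
      IsMesh a b N x → IsMeshSize N x h →
      ∀ u : ℝ → ℝ, ContDiff ℝ (k + 1) u →
      ∀ p : ℕ → Polynomial ℝ, (∀ i ∈ Finset.Icc 1 N, IsElemProj k u (x (i - 1)) (x i) (p i)) →
      ∀ i ∈ Finset.Icc 1 N, ∀ M : ℝ,
        (∀ y ∈ Set.Ioo (x (i - 1)) (x i), |iteratedDeriv (k + 1) u y| ≤ M) →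
        ∀ y ∈ Set.Ioo (x (i - 1)) (x i),
          |u y - (p i).eval y| + h * |deriv u y - (Polynomial.derivative (p i)).eval y|
            ≤ C * h ^ (k + 1) * M := by
  refine ⟨2, two_pos, ?_⟩
  intro a b _ N x h _ hh u hu p hp i hi M hM y hy
  have hlr : x (i - 1) < x i := hy.1.trans hy.2
  have hle : x i - x (i - 1) ≤ h := hh.1 i hi
  have hpos : 0 ≤ x i - x (i - 1) := (sub_pos.mpr hlr).le
  have hM0 : 0 ≤ M := (abs_nonneg _).trans (hM y hy)
  have hy' := Set.Ioo_subset_Icc_self hy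
  have hbound {n m : ℕ} (hnm : n + m = k + 1) := (hp i hi).abs_iteratedDeriv_sub_le
    (by omega) hlr hu hM hnm y hy'
  have e0 : |u y - (p i).eval y| ≤ M * h ^ (k + 1) := by
    have h0 := hbound (Nat.zero_add (k + 1))
    simp only [iteratedDeriv_zero, Function.iterate_zero, id] at h0
    exact h0.trans (by gcongr)
  have e1 : |deriv u y - (Polynomial.derivative (p i)).eval y| ≤ M * h ^ k := by
    have h1 := hbound (Nat.add_comm 1 k)
    simp only [iteratedDeriv_one, Function.iterate_one] at h1
    exact h1.trans (by gcongr)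
  calc _ ≤ M * h ^ (k + 1) + h * (M * h ^ k) :=
        add_le_add e0 (mul_le_mul_of_nonneg_left e1 (hpos.trans hle))
    _ = 2 * h ^ (k + 1) * M := by ring
end

section
/- Let k ≥ 4. There exists a constant C depending only on k such that for every (k+2)-times continuously differentiable u on [a,b] and every element τ_i, the truncated Jacobi projection u_I satisfies (u-u_I)(x_{i-1}) = (u-u_I)(x_i) = 0 and |(u-u_I)(l_{im})| ≤ C h^{k+2} |u|_{k+2,∞,τ_i} at each of the k-3 interior Jacobi points l_{im} of τ_i. -/
open Set Finset intervalIntegral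

section Polynomials

open Polynomial

theorem iteratedDeriv_polynomial_eval_s4 (P : ℝ[X]) (m : ℕ) :
    iteratedDeriv m (fun t => P.eval t) = fun t => (derivative^[m] P).eval t := by
  induction m with
  | zero => simp
  | succ m ih =>
    rw [iteratedDeriv_succ, ih, Function.iterate_succ_apply']
    ext t
    exact Polynomial.deriv _

theorem legendre_eq_eval (n : ℕ) :
    legendre n = fun s =>
      (C (1 / ((2 : ℝ) ^ n * n.factorial)) * derivative^[n] ((X ^ 2 - 1) ^ n)).eval s := by
  have h : (fun t : ℝ => (t ^ 2 - 1) ^ n) = fun t => ((X ^ 2 - 1 : ℝ[X]) ^ n).eval t := by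
    ext t; simp
  ext s
  rw [legendre, h, iteratedDeriv_polynomial_eval_s4, eval_mul, eval_C]

theorem eval_iterate_derivative_of_legendre_eq_zero {n m : ℕ} {s : ℝ}
    (hs : iteratedDeriv m (legendre n) s = 0) :
    (derivative^[n + m] ((X ^ 2 - 1 : ℝ[X]) ^ n)).eval s = 0 := by
  rw [legendre_eq_eval, iteratedDeriv_polynomial_eval_s4, iterate_derivative_C_mul,
    ← Function.iterate_add_apply, add_comm m n] at hs
  simp only [eval_mul, eval_C] at hs
  refine (mul_eq_zero.mp hs).resolve_left ?_
  positivity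

theorem iterate_derivative_comp_C_mul_X_add_C (P : ℝ[X]) (r c : ℝ) (m : ℕ) :
    derivative^[m] (P.comp (C r * X + C c)) =
      C (r ^ m) * (derivative^[m] P).comp (C r * X + C c) := by
  induction m with
  | zero => simp
  | succ m ih =>
    rw [Function.iterate_succ_apply', ih, Function.iterate_succ_apply', derivative_C_mul,
      derivative_comp]
    simp only [derivative_add, derivative_C_mul, derivative_X, derivative_C, pow_succ, C_mul]
    ring

/-- The monic quadratic vanishing at the end points of `[a, b]`. -/
noncomputable def endpointQuadratic (a b : ℝ) : ℝ[X] := (X - C a) * (X - C b)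

theorem endpointQuadratic_monic (a b : ℝ) : (endpointQuadratic a b).Monic :=
  (monic_X_sub_C a).mul (monic_X_sub_C b)

theorem natDegree_endpointQuadratic (a b : ℝ) : (endpointQuadratic a b).natDegree = 2 := by
  rw [endpointQuadratic, (monic_X_sub_C a).natDegree_mul (monic_X_sub_C b)]
  simp

theorem eval_eq_zero_of_endpointQuadratic_dvd {a b : ℝ} {f : ℝ[X]}
    (h : endpointQuadratic a b ∣ f) : f.eval a = 0 ∧ f.eval b = 0 := by
  obtain ⟨g, rfl⟩ := h
  simp [endpointQuadratic]

theorem eval_affMap_iterate_derivative_endpointQuadratic_pow {a b s : ℝ} (hab : a < b) {n m : ℕ}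
    (hs : (derivative^[m] ((X ^ 2 - 1 : ℝ[X]) ^ n)).eval s = 0) :
    (derivative^[m] (endpointQuadratic a b ^ n)).eval (affMap a b s) = 0 := by
  have hcomp : (endpointQuadratic a b ^ n).comp (C ((b - a) / 2) * X + C ((a + b) / 2)) =
      C (((b - a) / 2) ^ (2 * n)) * (X ^ 2 - 1) ^ n := by
    rw [pow_comp, pow_mul, C_pow, ← mul_pow]
    congr 1
    refine Polynomial.funext fun t => ?_
    simp [endpointQuadratic]
    ring
  have h := iterate_derivative_comp_C_mul_X_add_C
    (endpointQuadratic a b ^ n) ((b - a) / 2) ((a + b) / 2) m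
  rw [hcomp, iterate_derivative_C_mul] at h
  have h' := congrArg (Polynomial.eval s) h
  rw [eval_mul, eval_mul, hs, mul_zero, eval_C, eval_comp] at h'
  have hr : ((b - a) / 2) ^ m ≠ 0 := pow_ne_zero _ (by linarith)
  have h0 := (mul_eq_zero.mp h'.symm).resolve_left hr
  have haff : (C ((b - a) / 2) * X + C ((a + b) / 2)).eval s = affMap a b s := by
    simp only [eval_add, eval_mul, eval_C, eval_X, affMap]
    ring
  rwa [haff] at h0

theorem integral_eval_iterate_derivative_mul {a b : ℝ} (m : ℕ) (f g : ℝ[X])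
    (hf : endpointQuadratic a b ^ m ∣ f) :
    ∫ t in a..b, (derivative^[m] f).eval t * g.eval t =
      (-1) ^ m * ∫ t in a..b, f.eval t * (derivative^[m] g).eval t := by
  induction m generalizing g with
  | zero => simp
  | succ m ih =>
    have hd : endpointQuadratic a b ∣ derivative^[m] f := by
      have := pow_sub_dvd_iterate_derivative_of_pow_dvd m hf
      rwa [Nat.add_sub_cancel_left, pow_one] at this
    obtain ⟨ha, hb⟩ := eval_eq_zero_of_endpointQuadratic_dvd hd
    have hparts := integral_deriv_mul_eq_sub (a := a) (b := b)
      (u := fun t => (derivative^[m] f).eval t) (v := fun t => g.eval t)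
      (fun t _ => (derivative^[m] f).hasDerivAt t) (fun t _ => g.hasDerivAt t)
      (Continuous.intervalIntegrable (Polynomial.continuous _) _ _)
      (Continuous.intervalIntegrable (Polynomial.continuous _) _ _)
    rw [integral_add (Continuous.intervalIntegrable (by fun_prop) _ _)
      (Continuous.intervalIntegrable (by fun_prop) _ _), ha, hb,
      ih (derivative g) ((pow_dvd_pow _ m.le_succ).trans hf)] at hparts
    rw [Function.iterate_succ_apply', Function.iterate_succ_apply, pow_succ]
    linarith

/-- A multiple of the generalized Jacobi polynomial of degree `n + 2`, scaled to `[a, b]`. -/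
noncomputable def jacobiBubble (a b : ℝ) (n : ℕ) : ℝ[X] :=
  endpointQuadratic a b ^ 2 * derivative^[n + 2] (endpointQuadratic a b ^ n)

theorem integral_jacobiBubble_derivative_two_mul_eq_zero {a b : ℝ} {n : ℕ} (hn : 3 ≤ n) {q : ℝ[X]}
    (hq : q.natDegree ≤ n - 1) :
    ∫ t in a..b, (derivative^[2] (jacobiBubble a b n)).eval t * q.eval t = 0 := by
  rw [integral_eval_iterate_derivative_mul 2 (jacobiBubble a b n) _ (Dvd.intro _ rfl)]
  have h₁ := integral_eval_iterate_derivative_mul (a := a) (b := b) 2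
    (endpointQuadratic a b ^ 2 * derivative^[2] q) (derivative^[n] (endpointQuadratic a b ^ n))
    (Dvd.intro _ rfl)
  have h₂ := integral_eval_iterate_derivative_mul (a := a) (b := b) n
    (endpointQuadratic a b ^ n) (derivative^[2] (endpointQuadratic a b ^ 2 * derivative^[2] q))
    dvd_rfl
  have hzero :
      derivative^[n] (derivative^[2] (endpointQuadratic a b ^ 2 * derivative^[2] q)) = 0 := by
    rw [← Function.iterate_add_apply]
    refine iterate_derivative_eq_zero ?_
    have hd := natDegree_iterate_derivative q 2
    have hm := natDegree_mul_le (p := endpointQuadratic a b ^ 2) (q := derivative^[2] q)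
    rw [natDegree_pow, natDegree_endpointQuadratic] at hm
    omega
  rw [hzero] at h₂
  simp only [eval_zero, mul_zero, intervalIntegral.integral_zero] at h₂
  have h₃ : ∫ t in a..b, (jacobiBubble a b n).eval t * (derivative^[2] q).eval t =
      ∫ t in a..b, (endpointQuadratic a b ^ 2 * derivative^[2] q).eval t *
        (derivative^[2] (derivative^[n] (endpointQuadratic a b ^ n))).eval t := by
    refine intervalIntegral.integral_congr fun t _ => ?_
    simp only [jacobiBubble, ← Function.iterate_add_apply, eval_mul, add_comm 2 n]
    ring
  simp only [mul_comm (eval _ (derivative^[n] (endpointQuadratic a b ^ n)))] at h₂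
  rw [h₂] at h₁
  rw [h₃]
  linarith

theorem natDegree_jacobiBubble_le (a b : ℝ) {n : ℕ} (hn : 2 ≤ n) :
    (jacobiBubble a b n).natDegree ≤ n + 2 := by
  have hd := natDegree_iterate_derivative (endpointQuadratic a b ^ n) (n + 2)
  have hm := natDegree_mul_le (p := endpointQuadratic a b ^ 2)
    (q := derivative^[n + 2] (endpointQuadratic a b ^ n))
  rw [natDegree_pow, natDegree_endpointQuadratic] at hd hm
  rw [jacobiBubble]
  omega

theorem coeff_jacobiBubble_ne_zero (a b : ℝ) {n : ℕ} (hn : 2 ≤ n) :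
    (jacobiBubble a b n).coeff (n + 2) ≠ 0 := by
  have hd := natDegree_iterate_derivative (endpointQuadratic a b ^ n) (n + 2)
  have hW := (endpointQuadratic_monic a b).pow n
  have hW2 := (endpointQuadratic_monic a b).pow 2
  have hWd : (endpointQuadratic a b ^ n).natDegree = n - 2 + (n + 2) := by
    rw [natDegree_pow, natDegree_endpointQuadratic]; omega
  have hW2d : (endpointQuadratic a b ^ 2).natDegree = 4 := by
    rw [natDegree_pow, natDegree_endpointQuadratic]
  have hcoeff := coeff_mul_add_eq_of_natDegree_le hW2d.le
    (show (derivative^[n + 2] (endpointQuadratic a b ^ n)).natDegree ≤ n - 2 by omega)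
  rw [show 4 + (n - 2) = n + 2 by omega] at hcoeff
  rw [jacobiBubble, hcoeff, ← hW2d, hW2.coeff_natDegree, coeff_iterate_derivative,
    ← hWd, hW.coeff_natDegree, hWd]
  simp only [one_mul, nsmul_eq_mul, mul_one, ne_eq, Nat.cast_eq_zero]
  rw [Nat.descFactorial_eq_zero_iff_lt]
  omega

theorem exists_polynomial_antiderivative (P : ℝ[X]) (a c : ℝ) :
    ∃ Q : ℝ[X], derivative Q = P ∧ Q.eval a = c ∧
      ∀ n : ℕ, P.degree < n → Q.degree < (n + 1 : ℕ) := by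
  set S : ℝ[X] := P.sum fun i r => monomial (i + 1) (r / (i + 1)) with hS
  have hdS : derivative S = P := by
    rw [hS, Polynomial.sum, derivative_sum]
    conv_rhs => rw [P.as_sum_support]
    refine Finset.sum_congr rfl fun i _ => ?_
    rw [derivative_monomial]
    have : (i : ℝ) + 1 ≠ 0 := by positivity
    simp [div_mul_cancel₀ _ this]
  refine ⟨S + C (c - S.eval a), by simp [hdS], by simp, fun n hn => ?_⟩
  refine (degree_add_le _ _).trans_lt (max_lt ?_ ?_)
  · rw [hS, Polynomial.sum]
    refine (degree_sum_le _ _).trans_lt ((Finset.sup_lt_iff (WithBot.bot_lt_coe _)).mpr ?_)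
    intro i hi
    have hin : i < n := by
      exact_mod_cast (le_degree_of_mem_supp i hi).trans_lt hn
    exact (degree_monomial_le _ _).trans_lt (by exact_mod_cast Nat.succ_lt_succ hin)
  · exact degree_C_le.trans_lt (by exact_mod_cast n.succ_pos)

end Polynomials

section Estimates

open Polynomial

theorem exists_polynomial_abs_sub_le {a b : ℝ} (m : ℕ) (f : ℝ → ℝ) (M : ℝ)
    (hf : ContDiff ℝ m f) (hM : ∀ y ∈ Set.Icc a b, |iteratedDeriv m f y| ≤ M) :
    ∃ T : ℝ[X], T.degree < m ∧ ∀ y ∈ Set.Icc a b, |f y - T.eval y| ≤ M * (b - a) ^ m := by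
  induction m generalizing f with
  | zero => exact ⟨0, by simp, by simpa using hM⟩
  | succ m ih =>
    have hf' : ContDiff ℝ ((m : WithTop ℕ∞) + 1) f := by exact_mod_cast hf
    obtain ⟨hdiff, -, hderiv⟩ := contDiff_succ_iff_deriv.mp hf'
    obtain ⟨T, hT, hTf⟩ := ih (deriv f) hderiv (by simpa only [iteratedDeriv_succ'] using hM)
    obtain ⟨Q, hQ, hQa, hdeg⟩ := exists_polynomial_antiderivative T a (f a)
    refine ⟨Q, hdeg m hT, fun y hy => ?_⟩
    have key := norm_image_sub_le_of_norm_deriv_le_segment' (f := fun t => f t - Q.eval t)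
      (f' := fun t => deriv f t - T.eval t) (C := M * (b - a) ^ m)
      (fun t _ => ((hdiff t).hasDerivAt.sub (hQ ▸ Q.hasDerivAt t)).hasDerivWithinAt)
      (fun t ht => hTf t (Set.Ico_subset_Icc_self ht)) y hy
    have hnn : 0 ≤ M * (b - a) ^ m := (abs_nonneg _).trans (hTf y hy)
    rw [hQa, sub_self, sub_zero, Real.norm_eq_abs] at key
    refine key.trans ?_
    rw [pow_succ, ← mul_assoc]
    exact mul_le_mul_of_nonneg_left (by linarith [hy.2]) hnn

theorem sq_integral_le_mul_integral_sq {g : ℝ → ℝ} (hg : Continuous g) {a b : ℝ} (hab : a ≤ b) :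
    (∫ t in a..b, g t) ^ 2 ≤ (b - a) * ∫ t in a..b, g t ^ 2 := by
  rcases hab.eq_or_lt with rfl | hlt
  · simp
  have hl : 0 < b - a := sub_pos.mpr hlt
  set I := ∫ t in a..b, g t with hI
  have hnn : 0 ≤ ∫ t in a..b, (g t - I / (b - a)) ^ 2 :=
    intervalIntegral.integral_nonneg hab fun t _ => sq_nonneg _
  have hexp : ∫ t in a..b, (g t - I / (b - a)) ^ 2 =
      (∫ t in a..b, g t ^ 2) - 2 * (I / (b - a)) * I + (b - a) * (I / (b - a)) ^ 2 := by
    have : ∀ t, (g t - I / (b - a)) ^ 2 =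
        g t ^ 2 - 2 * (I / (b - a)) * g t + (I / (b - a)) ^ 2 := fun t => by ring
    simp only [this]
    rw [integral_add (Continuous.intervalIntegrable (by fun_prop) _ _)
        (Continuous.intervalIntegrable (by fun_prop) _ _),
      integral_sub (Continuous.intervalIntegrable (by fun_prop) _ _)
        (Continuous.intervalIntegrable (by fun_prop) _ _),
      intervalIntegral.integral_const_mul, intervalIntegral.integral_const, smul_eq_mul, ← hI]
  rw [hexp] at hnn
  have h := mul_nonneg hl.le hnn
  have heq : (b - a) * ((∫ t in a..b, g t ^ 2) - 2 * (I / (b - a)) * I +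
      (b - a) * (I / (b - a)) ^ 2) = (b - a) * (∫ t in a..b, g t ^ 2) - I ^ 2 := by
    field_simp
    ring
  linarith

theorem integral_sq_le_of_orthogonal {g q : ℝ → ℝ} (hg : Continuous g) (hq : Continuous q)
    {a b B : ℝ} (hab : a ≤ b) (horth : ∫ t in a..b, g t * q t = 0)
    (hB : ∀ t ∈ Set.Icc a b, |g t - q t| ≤ B) :
    ∫ t in a..b, g t ^ 2 ≤ (b - a) * B ^ 2 := by
  have hmono : ∫ t in a..b, (g t ^ 2 - 2 * (g t * q t)) ≤ ∫ _ in a..b, B ^ 2 := by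
    refine intervalIntegral.integral_mono_on hab
      (Continuous.intervalIntegrable (by fun_prop) _ _)
      (Continuous.intervalIntegrable (by fun_prop) _ _) fun t ht => ?_
    have := sq_le_sq' (abs_le.mp (hB t ht)).1 (abs_le.mp (hB t ht)).2
    nlinarith [sq_nonneg (q t)]
  rw [integral_sub (Continuous.intervalIntegrable (by fun_prop) _ _)
    (Continuous.intervalIntegrable (by fun_prop) _ _), intervalIntegral.integral_const_mul,
    horth, intervalIntegral.integral_const, smul_eq_mul] at hmono
  linarith

theorem abs_le_of_deriv_two_orthogonal {z q : ℝ → ℝ} (hz : ContDiff ℝ 2 z) (hq : Continuous q)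
    {a b B : ℝ} (hab : a ≤ b) (hza : z a = 0) (hza' : deriv z a = 0)
    (horth : ∫ t in a..b, deriv (deriv z) t * q t = 0)
    (hB : ∀ t ∈ Set.Icc a b, |deriv (deriv z) t - q t| ≤ B) :
    ∀ t ∈ Set.Icc a b, |z t| ≤ B * (b - a) ^ 2 := by
  obtain ⟨hdiff, -, hz'⟩ := contDiff_succ_iff_deriv.mp
    (show ContDiff ℝ ((1 : WithTop ℕ∞) + 1) z by simpa [one_add_one_eq_two] using hz)
  have hcont : Continuous (deriv (deriv z)) := (contDiff_one_iff_deriv.mp hz').2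
  have hdiff' := (contDiff_one_iff_deriv.mp hz').1
  have hBnn : 0 ≤ B := (abs_nonneg _).trans (hB a (Set.left_mem_Icc.mpr hab))
  have hl : 0 ≤ b - a := sub_nonneg.mpr hab
  have hL2 := integral_sq_le_of_orthogonal hcont hq hab horth hB
  have hderiv : ∀ t ∈ Set.Icc a b, |deriv z t| ≤ B * (b - a) := by
    intro t ht
    have hint : ∫ s in a..t, deriv (deriv z) s = deriv z t := by
      rw [integral_deriv_eq_sub (fun s _ => hdiff' s) (hcont.intervalIntegrable _ _), hza',
        sub_zero]
    have hcs := sq_integral_le_mul_integral_sq hcont ht.1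
    have hsub : ∫ s in a..t, deriv (deriv z) s ^ 2 ≤ ∫ s in a..b, deriv (deriv z) s ^ 2 := by
      refine intervalIntegral.integral_mono_interval le_rfl ht.1 ht.2
        (Filter.Eventually.of_forall fun s => sq_nonneg _)
        (Continuous.intervalIntegrable (by fun_prop) _ _)
    rw [hint] at hcs
    refine abs_le_of_sq_le_sq ?_ (mul_nonneg hBnn hl)
    calc deriv z t ^ 2 ≤ (t - a) * ∫ s in a..t, deriv (deriv z) s ^ 2 := hcs
      _ ≤ (b - a) * ((b - a) * B ^ 2) := by
        refine mul_le_mul (by linarith [ht.2]) (hsub.trans hL2) ?_ hl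
        exact intervalIntegral.integral_nonneg ht.1 fun s _ => sq_nonneg _
      _ = (B * (b - a)) ^ 2 := by ring
  intro t ht
  have key := norm_image_sub_le_of_norm_deriv_le_segment' (f := z) (f' := deriv z)
    (C := B * (b - a)) (fun t _ => (hdiff t).hasDerivAt.hasDerivWithinAt)
    (fun t ht => hderiv t (Set.Ico_subset_Icc_self ht)) t ht
  rw [hza, sub_zero, Real.norm_eq_abs] at key
  refine key.trans ?_
  rw [pow_two, ← mul_assoc]
  exact mul_le_mul_of_nonneg_left (by linarith [ht.2]) (mul_nonneg hBnn hl)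

theorem IsElemProj.abs_sub_eval_affMap_le {k : ℕ} (hk : 4 ≤ k) {u : ℝ → ℝ}
    (hu : ContDiff ℝ (k + 2) u) {a b : ℝ} (hab : a < b) {p : ℝ[X]} (hp : IsElemProj k u a b p)
    {M : ℝ} (hM : ∀ y ∈ Set.Ioo a b, |iteratedDeriv (k + 2) u y| ≤ M) {s : ℝ}
    (hs : s ∈ Set.Ioo (-1 : ℝ) 1) (hroot : iteratedDeriv 2 (legendre (k - 1)) s = 0) :
    |u (affMap a b s) - p.eval (affMap a b s)| ≤ M * (b - a) ^ (k + 2) := by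
  obtain ⟨hdeg, hpa, -, hpa', -, horth⟩ := hp
  obtain ⟨hud, -, hu'⟩ := contDiff_succ_iff_deriv.mp
    (show ContDiff ℝ (((k : WithTop ℕ∞) + 1) + 1) u by rwa [add_assoc, one_add_one_eq_two])
  obtain ⟨hud', -, hu''⟩ := contDiff_succ_iff_deriv.mp hu'
  have hM' : ∀ y ∈ Set.Icc a b, |iteratedDeriv k (deriv (deriv u)) y| ≤ M := by
    have hc : Continuous fun y => |iteratedDeriv (k + 2) u y| :=
      (hu.continuous_iteratedDeriv (k + 2) (by norm_cast)).abs
    intro y hy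
    rw [← closure_Ioo hab.ne] at hy
    rw [← iteratedDeriv_succ', ← iteratedDeriv_succ']
    exact closure_minimal hM (isClosed_le hc continuous_const) hy
  obtain ⟨T, hT, hTu⟩ := exists_polynomial_abs_sub_le k _ M hu'' hM'
  set J := jacobiBubble a b (k - 1) with hJ
  have hk1 : k - 1 + 2 = k + 1 := by omega
  have hJc : (derivative^[2] J).coeff (k - 1) ≠ 0 := by
    rw [coeff_iterate_derivative, hk1, nsmul_eq_mul, ← hk1]
    refine mul_ne_zero ?_ (coeff_jacobiBubble_ne_zero a b (by omega))
    rw [Nat.cast_ne_zero, ne_eq, Nat.descFactorial_eq_zero_iff_lt]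
    omega
  set c := T.coeff (k - 1) / (derivative^[2] J).coeff (k - 1) with hc
  set P := p + C c * J with hP
  set q := T - derivative^[2] P with hq
  have hJd : (derivative^[2] J).natDegree ≤ k - 1 := by
    have h₁ := natDegree_iterate_derivative J 2
    have h₂ : J.natDegree ≤ k - 1 + 2 := natDegree_jacobiBubble_le a b (by omega)
    omega
  have hpd : (derivative^[2] p).natDegree ≤ k - 2 :=
    (natDegree_iterate_derivative p 2).trans (by omega)
  have hqd : q.natDegree ≤ k - 2 := by
    rw [natDegree_le_iff_coeff_eq_zero]
    intro i hi
    rw [hq, hP, iterate_map_add, iterate_derivative_C_mul, coeff_sub, coeff_add, coeff_C_mul,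
      coeff_eq_zero_of_natDegree_lt (hpd.trans_lt hi), zero_add]
    rcases (show k - 1 ≤ i by omega).eq_or_lt with rfl | hlt
    · rw [hc, div_mul_cancel₀ _ hJc, sub_self]
    · rw [coeff_eq_zero_of_natDegree_lt (hJd.trans_lt hlt), mul_zero, sub_zero]
      exact coeff_eq_zero_of_degree_lt (hT.trans_le (by exact_mod_cast (by omega : k ≤ i)))
  have hbubble := integral_jacobiBubble_derivative_two_mul_eq_zero (a := a) (b := b)
    (n := k - 1) (by omega) (q := q) (by omega)
  have hortho := horth q hqd
  have hd1 : deriv (fun t => u t - P.eval t) = fun t => deriv u t - (derivative P).eval t :=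
    funext fun t => ((hud t).hasDerivAt.sub (P.hasDerivAt t)).deriv
  have hd2 : deriv (deriv (fun t => u t - P.eval t)) =
      fun t => deriv (deriv u) t - (derivative^[2] P).eval t := by
    rw [hd1]
    exact funext fun t => ((hud' t).hasDerivAt.sub ((derivative P).hasDerivAt t)).deriv
  have hJa : J.eval a = 0 :=
    (eval_eq_zero_of_endpointQuadratic_dvd (b := b)
      ((dvd_pow_self _ two_ne_zero).trans (Dvd.intro _ rfl))).1
  have hJa' : (derivative J).eval a = 0 := by
    refine (eval_eq_zero_of_endpointQuadratic_dvd (b := b) ?_).1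
    have := pow_sub_dvd_iterate_derivative_of_pow_dvd 1
      (show endpointQuadratic a b ^ 2 ∣ J from Dvd.intro _ rfl)
    simpa using this
  have hJs : J.eval (affMap a b s) = 0 := by
    rw [hJ, jacobiBubble, eval_mul, eval_affMap_iterate_derivative_endpointQuadratic_pow hab
      (eval_iterate_derivative_of_legendre_eq_zero hroot), mul_zero]
  have hmem : affMap a b s ∈ Set.Icc a b := by
    constructor <;> rw [affMap] <;> nlinarith [hs.1, hs.2]
  have hcont2 : Continuous (deriv (deriv u)) := hu''.continuous
  have key := abs_le_of_deriv_two_orthogonal (z := fun t => u t - P.eval t)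
    (q := fun t => q.eval t) (a := a) (b := b) (B := M * (b - a) ^ k)
    ((hu.of_le (by exact_mod_cast (by omega : 2 ≤ k + 2))).sub
      (by simpa using P.contDiff_aeval (𝕜 := ℝ) 2)) q.continuous hab.le
    (by simp [hP, hpa, hJa]) (by rw [hd1]; simp [hP, hpa', hJa'])
    (by
      rw [hd2]
      have hsplit : ∀ t, (deriv (deriv u) t - (derivative^[2] P).eval t) * q.eval t =
          (iteratedDeriv 2 u t - (derivative (derivative p)).eval t) * q.eval t -
            c * ((derivative^[2] J).eval t * q.eval t) := by
        intro t
        rw [hP, iterate_map_add, iterate_derivative_C_mul, iteratedDeriv_succ',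
          iteratedDeriv_one, eval_add, eval_mul, eval_C]
        simp only [Function.iterate_succ, Function.comp, Function.iterate_zero, id]
        ring
      have hcont3 : Continuous (iteratedDeriv 2 u) := by
        rwa [iteratedDeriv_succ', iteratedDeriv_one]
      simp only [hsplit]
      rw [integral_sub (Continuous.intervalIntegrable (by fun_prop) _ _)
        (Continuous.intervalIntegrable (by fun_prop) _ _), hortho,
        intervalIntegral.integral_const_mul, hbubble, mul_zero, sub_zero])
    (fun t ht => by
      rw [hd2]
      simpa [hq] using hTu t ht)
    _ hmem
  simp only [hP, eval_add, eval_mul, eval_C, hJs, mul_zero, add_zero] at key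
  rwa [mul_assoc, ← pow_add] at key

end Estimates

/-- Superconvergence of the truncated Jacobi projection at the interior Jacobi points
(images under the affine map onto `τ_i` of the roots of `L_{k-1}''`), for `k ≥ 4`:
`u - u_I` vanishes at the element endpoints and is `O(h^{k+2})` at the Jacobi points. -/
theorem truncated_jacobi_projection_superconvergence_jacobi_points (k : ℕ) (hk : 4 ≤ k) :
    ∃ C > 0, ∀ (a b : ℝ), a < b → ∀ (N : ℕ) (x : ℕ → ℝ) (h : ℝ),
      IsMesh a b N x → IsMeshSize N x h →
      ∀ u : ℝ → ℝ, ContDiff ℝ (k + 2) u →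
      ∀ p : ℕ → Polynomial ℝ, (∀ i ∈ Finset.Icc 1 N, IsElemProj k u (x (i - 1)) (x i) (p i)) →
      ∀ i ∈ Finset.Icc 1 N, ∀ M : ℝ,
        (∀ y ∈ Set.Ioo (x (i - 1)) (x i), |iteratedDeriv (k + 2) u y| ≤ M) →
        (u (x (i - 1)) - (p i).eval (x (i - 1)) = 0) ∧
        (u (x i) - (p i).eval (x i) = 0) ∧
        ∀ s ∈ Set.Ioo (-1 : ℝ) 1, iteratedDeriv 2 (legendre (k - 1)) s = 0 →
          |u (affMap (x (i - 1)) (x i) s) - (p i).eval (affMap (x (i - 1)) (x i) s)|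
            ≤ C * h ^ (k + 2) * M := by
  refine ⟨1, one_pos, ?_⟩
  intro a b _ N x h hmesh hsize u hu p hp i hi M hM
  have hproj := hp i hi
  refine ⟨sub_eq_zero.mpr hproj.2.1.symm, sub_eq_zero.mpr hproj.2.2.1.symm, fun s hs hroot => ?_⟩
  obtain ⟨hi₁, hi₂⟩ := Finset.mem_Icc.mp hi
  have hlt : x (i - 1) < x i := by
    have := hmesh.2.2.2 (i - 1) (by omega)
    rwa [Nat.sub_add_cancel hi₁] at this
  have hMnn : 0 ≤ M := by
    obtain ⟨y, hy⟩ := exists_between hlt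
    exact (abs_nonneg _).trans (hM y hy)
  refine (hproj.abs_sub_eval_affMap_le hk hu hlt hM hs hroot).trans ?_
  rw [one_mul, mul_comm]
  exact mul_le_mul_of_nonneg_right
    (pow_le_pow_left₀ (sub_nonneg.mpr hlt.le) (hsize.1 i hi) _) hMnn
end
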